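/- arXiv:1910.04276 — 3 statements merged into one kernel-verified Lean document; each statement's English description precedes it below -/
import Mathlib

section
/- Let 0 < α < 1 and let f be a Schwartz function on ℝ. If f(log(n+1)) = f(-log(n+1)) = 0 and f̂(n^α) = f̂(-n^α) = 0 for every natural number n ≥ 0, then f is identically zero. -/
open MeasureTheory

/-- The Fourier transform `f̂(ξ) = ∫_ℝ f(x) e^{2πi x ξ} dx`. -/
noncomputable def fourierTransform (f : ℝ → ℂ) (ξ : ℝ) : ℂ :=
  ∫ x : ℝ, f x * Complex.exp (2 * Real.pi * Complex.I * x * ξ)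

/-- Iterated Rolle theorem: a smooth function with `k + 1` zeros has a zero of its `k`-th
derivative. -/
theorem exists_iteratedDeriv_eq_zero {k : ℕ} {h : ℝ → ℝ} (hh : ContDiff ℝ (⊤ : ℕ∞) h)
    {a : Fin (k + 1) → ℝ} (ha : StrictMono a) (hz : ∀ i, h (a i) = 0) :
    ∃ ξ, iteratedDeriv k h ξ = 0 := by
  induction k generalizing h with
  | zero => exact ⟨a 0, by simpa using hz 0⟩
  | succ k ih =>
    have hex : ∀ i : Fin (k + 1), ∃ c ∈ Set.Ioo (a i.castSucc) (a i.succ), deriv h c = 0 :=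
      fun i ↦ exists_deriv_eq_zero (ha Fin.castSucc_lt_succ)
        hh.continuous.continuousOn (by rw [hz, hz])
    choose b hb hb0 using hex
    have hbm : StrictMono b := by
      intro i j hij
      exact (hb i).2.trans_le ((ha.monotone (Fin.succ_le_castSucc_iff.mpr hij)).trans (hb j).1.le)
    obtain ⟨ξ, hξ⟩ := ih (contDiff_infty_iff_deriv.mp hh).2 hbm hb0
    exact ⟨ξ, by rwa [iteratedDeriv_succ']⟩

theorem iteratedDeriv_polynomial_eval (p : Polynomial ℝ) (k : ℕ) :
    iteratedDeriv k (fun t ↦ p.eval t) = fun t ↦ (Polynomial.derivative^[k] p).eval t := by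
  induction k generalizing p with
  | zero => simp
  | succ k ih =>
    rw [iteratedDeriv_succ', Function.iterate_succ_apply, ← ih]
    congr 1
    ext t
    exact p.deriv

/-- Lagrange interpolation error formula for the zero interpolant. -/
theorem exists_eq_prod_sub_mul_iteratedDeriv {h : ℝ → ℝ} (hh : ContDiff ℝ (⊤ : ℕ∞) h)
    {s : Finset ℝ} (hz : ∀ z ∈ s, h z = 0) (x : ℝ) :
    ∃ ξ, h x * (s.card.factorial : ℝ) = (∏ z ∈ s, (x - z)) * iteratedDeriv s.card h ξ := by
  by_cases hx : x ∈ s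
  · exact ⟨0, by rw [hz x hx, Finset.prod_eq_zero hx (sub_self x)]; simp⟩
  set p : Polynomial ℝ := ∏ z ∈ s, (Polynomial.X - Polynomial.C z) with hp
  have hpe : ∀ t, p.eval t = ∏ z ∈ s, (t - z) := fun t ↦ by simp [hp, Polynomial.eval_prod]
  have hpx : p.eval x ≠ 0 := by
    rw [hpe, Finset.prod_ne_zero_iff]
    exact fun z hz' h0 ↦ hx (by rwa [sub_eq_zero.mp h0])
  set c := h x / p.eval x with hc
  have hps : ContDiff ℝ (⊤ : ℕ∞) (fun t ↦ p.eval t) := by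
    simp_rw [hpe]
    fun_prop
  have hcard : (insert x s).card = s.card + 1 := Finset.card_insert_of_notMem hx
  obtain ⟨ξ, hξ⟩ := exists_iteratedDeriv_eq_zero (k := s.card) (h := fun t ↦ h t - c * p.eval t)
    (hh.sub (contDiff_const.mul hps)) ((insert x s).orderEmbOfFin hcard).strictMono (by
      intro i
      rcases Finset.mem_insert.mp ((insert x s).orderEmbOfFin_mem hcard i) with hi | hi
      · simp only [hi, hc]
        field_simp
        simp
      · simp only [hz _ hi, hpe, Finset.prod_eq_zero hi (sub_self _)]
        simp)
  refine ⟨ξ, ?_⟩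
  have hle : ((s.card : ℕ) : WithTop ℕ∞) ≤ ((⊤ : ℕ∞) : WithTop ℕ∞) := by exact_mod_cast le_top
  have hpd : iteratedDeriv s.card (fun t ↦ p.eval t) ξ = s.card.factorial := by
    rw [iteratedDeriv_polynomial_eval, hp, Polynomial.iterate_derivative_prod_X_sub_C le_rfl]
    simp
  rw [iteratedDeriv_fun_sub (hh.of_le hle).contDiffAt
    ((contDiff_const.mul hps).of_le hle).contDiffAt, iteratedDeriv_const_mul_field, hpd] at hξ
  rw [← hpe, sub_eq_zero.mp hξ, hc]
  field_simp

/-- A function with many zeros near `x` is small at `x`. -/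
theorem norm_le_of_zeros {E : Type*} [NormedAddCommGroup E] [NormedSpace ℝ E] {u : ℝ → E}
    (hu : ContDiff ℝ (⊤ : ℕ∞) u) {s : Finset ℝ}
    (hz : ∀ z ∈ s, u z = 0) {x L M : ℝ} (hL : ∀ z ∈ s, |x - z| ≤ L)
    (hM : ∀ ξ, ‖iteratedDeriv s.card u ξ‖ ≤ M) :
    ‖u x‖ ≤ L ^ s.card / s.card.factorial * M := by
  obtain ⟨g, hg, hgx⟩ := exists_dual_vector'' ℝ (u x)
  obtain ⟨ξ, hξ⟩ := exists_eq_prod_sub_mul_iteratedDeriv (h := g ∘ u) (g.contDiff.comp hu)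
    (s := s) (fun z hzs ↦ by simp [hz z hzs]) x
  have hle : ((s.card : ℕ) : WithTop ℕ∞) ≤ ((⊤ : ℕ∞) : WithTop ℕ∞) := by exact_mod_cast le_top
  have hd : |iteratedDeriv s.card (g ∘ u) ξ| ≤ M := by
    rw [← Real.norm_eq_abs, ← norm_iteratedFDeriv_eq_norm_iteratedDeriv]
    refine (g.norm_iteratedFDeriv_comp_left hu.contDiffAt hle).trans ?_
    rw [norm_iteratedFDeriv_eq_norm_iteratedDeriv]
    exact (mul_le_of_le_one_left (norm_nonneg _) hg).trans (hM ξ)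
  have hprod : |∏ z ∈ s, (x - z)| ≤ L ^ s.card := by
    rw [Finset.abs_prod, ← Finset.prod_const]
    exact Finset.prod_le_prod (fun _ _ ↦ abs_nonneg _) hL
  have hf : (0 : ℝ) < s.card.factorial := by positivity
  rw [div_mul_eq_mul_div, le_div_iff₀ hf]
  calc ‖u x‖ * s.card.factorial = (g ∘ u) x * s.card.factorial := by simp [hgx]
    _ ≤ |(∏ z ∈ s, (x - z)) * iteratedDeriv s.card (g ∘ u) ξ| := hξ ▸ le_abs_self _
    _ ≤ L ^ s.card * M := by
        rw [abs_mul]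
        exact mul_le_mul hprod hd (abs_nonneg _) ((abs_nonneg _).trans hprod)

open scoped FourierTransform

/-- Decay of the form `exp (-c |x| ^ p)`. -/
def StretchedExpDecay (u : ℝ → ℂ) (p : ℝ) : Prop :=
  ∃ C c : ℝ, 0 < c ∧ ∀ x, ‖u x‖ ≤ C * Real.exp (-(c * |x| ^ p))

/-- A uniform Gevrey-type bound of order `P` on all derivatives. -/
def GevreyBound (u : ℝ → ℂ) (P : ℝ) : Prop :=
  ∃ K D : ℝ, 0 ≤ K ∧ 0 < D ∧ ∀ (k : ℕ) ξ, ‖iteratedDeriv k u ξ‖ ≤ K * (D * (k : ℝ) ^ P) ^ k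

theorem integrable_exp_neg_mul_abs_rpow {p b : ℝ} (hp : 0 < p) (hb : 0 < b) :
    Integrable (fun x : ℝ ↦ Real.exp (-(b * |x| ^ p))) := by
  have h := integrableOn_rpow_mul_exp_neg_mul_rpow (s := 0) (by norm_num) hp hb
  have h0 : IntegrableOn (fun x : ℝ ↦ Real.exp (-(b * |x| ^ p))) (Set.Ioi 0) := by
    refine h.congr_fun (fun x hx ↦ ?_) measurableSet_Ioi
    simp [abs_of_pos (Set.mem_Ioi.mp hx)]
  have h1 : IntegrableOn (fun x : ℝ ↦ Real.exp (-(b * |x| ^ p))) (Set.Iic 0) := by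
    rw [integrableOn_Iic_iff_integrableOn_Iio]
    simpa using h0.comp_neg
  rw [← integrableOn_univ, ← Set.Iic_union_Ioi (a := (0 : ℝ))]
  exact h1.union h0

theorem rpow_mul_exp_neg_le {y s a : ℝ} (hy : 0 ≤ y) (hs : 0 < s) (ha : 0 < a) :
    y ^ s ≤ (s / a) ^ s * Real.exp (a * y) := by
  have ht : a * y / s ≤ Real.exp (a * y / s) := by linarith [Real.add_one_le_exp (a * y / s)]
  calc y ^ s = ((s / a) * (a * y / s)) ^ s := by congr 1; field_simp
    _ = (s / a) ^ s * (a * y / s) ^ s := Real.mul_rpow (by positivity) (by positivity)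
    _ ≤ (s / a) ^ s * Real.exp (a * y / s) ^ s := by gcongr
    _ = (s / a) ^ s * Real.exp (a * y) := by
        rw [← Real.exp_mul]
        congr 2
        field_simp

theorem abs_pow_mul_exp_neg_le {p c : ℝ} (hp : 0 < p) (hc : 0 < c) (k : ℕ) (x : ℝ) :
    |x| ^ k * Real.exp (-(c * |x| ^ p)) ≤
      ((2 / (p * c)) ^ p⁻¹ * (k : ℝ) ^ p⁻¹) ^ k * Real.exp (-(c / 2 * |x| ^ p)) := by
  rcases Nat.eq_zero_or_pos k with rfl | hk
  · simp only [pow_zero, one_mul]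
    gcongr
    linarith
  have hk' : (0 : ℝ) < k := by exact_mod_cast hk
  have h := rpow_mul_exp_neg_le (y := |x| ^ p) (s := k / p) (a := c / 2) (by positivity)
    (by positivity) (by positivity)
  have h1 : (|x| ^ p) ^ ((k : ℝ) / p) = |x| ^ k := by
    rw [← Real.rpow_mul (abs_nonneg x), mul_div_cancel₀ _ hp.ne', Real.rpow_natCast]
  have h2 : ((k : ℝ) / p / (c / 2)) ^ ((k : ℝ) / p) =
      ((2 / (p * c)) ^ p⁻¹ * (k : ℝ) ^ p⁻¹) ^ k := by
    rw [← Real.mul_rpow (by positivity) (by positivity), ← Real.rpow_mul_natCast (by positivity)]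
    congr 1 <;> field_simp
  rw [h1, h2] at h
  refine (mul_le_mul_of_nonneg_right h (Real.exp_nonneg _)).trans_eq ?_
  rw [mul_assoc, ← Real.exp_add]
  congr 2
  ring

theorem StretchedExpDecay.gevreyBound_fourier {u : SchwartzMap ℝ ℂ} {p : ℝ} (hp : 0 < p)
    (hu : StretchedExpDecay u p) : GevreyBound (𝓕 (u : ℝ → ℂ)) p⁻¹ := by
  obtain ⟨C, c, hc, hu⟩ := hu
  have hC : 0 ≤ C := by
    have h := (norm_nonneg _).trans (hu 0)
    exact nonneg_of_mul_nonneg_left h (Real.exp_pos _)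
  set I := ∫ x : ℝ, Real.exp (-(c / 2 * |x| ^ p)) with hI
  have hI0 : 0 ≤ I := integral_nonneg fun x ↦ (Real.exp_pos _).le
  refine ⟨C * I, 2 * Real.pi * (2 / (p * c)) ^ p⁻¹, by positivity, by positivity, fun k ξ ↦ ?_⟩
  have hmoment : ∀ n : ℕ, Integrable (fun x : ℝ ↦ x ^ n • u x) := fun n ↦ by
    refine ((u.integrable_pow_mul volume n).mono' ?_ (.of_forall fun x ↦ ?_))
    · exact (by fun_prop : Continuous fun x : ℝ ↦ x ^ n • u x).aestronglyMeasurable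
    · simp
  rw [Real.iteratedDeriv_fourier (N := ⊤) (fun n _ ↦ hmoment n) le_top]
  refine (VectorFourier.norm_fourierIntegral_le_integral_norm _ _ _ _ _).trans ?_
  calc ∫ x : ℝ, ‖(-2 * Real.pi * Complex.I * x) ^ k • u x‖
      ≤ ∫ x : ℝ, C * (2 * Real.pi) ^ k * ((2 / (p * c)) ^ p⁻¹ * (k : ℝ) ^ p⁻¹) ^ k *
          Real.exp (-(c / 2 * |x| ^ p)) := by
        refine integral_mono_of_nonneg (.of_forall fun x ↦ norm_nonneg _)
          ((integrable_exp_neg_mul_abs_rpow hp (half_pos hc)).const_mul _)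
          (.of_forall fun x ↦ ?_)
        have h1 : ‖(-2 * Real.pi * Complex.I * x) ^ k • u x‖ =
            (2 * Real.pi) ^ k * (|x| ^ k * ‖u x‖) := by
          simp [abs_of_pos Real.pi_pos, mul_pow, mul_assoc]
        simp only [h1]
        calc (2 * Real.pi) ^ k * (|x| ^ k * ‖u x‖)
            ≤ (2 * Real.pi) ^ k * (|x| ^ k * (C * Real.exp (-(c * |x| ^ p)))) := by
              gcongr; exact hu x
          _ = C * (2 * Real.pi) ^ k * (|x| ^ k * Real.exp (-(c * |x| ^ p))) := by ring
          _ ≤ C * (2 * Real.pi) ^ k * (((2 / (p * c)) ^ p⁻¹ * (k : ℝ) ^ p⁻¹) ^ k *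
                Real.exp (-(c / 2 * |x| ^ p))) := by
              exact mul_le_mul_of_nonneg_left (abs_pow_mul_exp_neg_le hp hc k x) (by positivity)
          _ = _ := by ring
    _ = _ := by
        rw [integral_const_mul, ← hI, mul_assoc (2 * Real.pi), mul_pow (2 * Real.pi)]
        ring

theorem pow_self_le_exp_mul_factorial (k : ℕ) :
    (k : ℝ) ^ k ≤ Real.exp 1 ^ k * k.factorial := by
  have h := Real.pow_div_factorial_le_exp (x := (k : ℝ)) (Nat.cast_nonneg k) k
  rw [div_le_iff₀ (by positivity)] at h
  rwa [← Real.exp_nat_mul, mul_one]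

/-- Zeros `z 0, z 1, …` with `|x - z j| ≤ (j + 1) δ` force smallness at `x`. -/
theorem norm_le_of_zero_sequence {u : ℝ → ℂ} (hu : ContDiff ℝ (⊤ : ℕ∞) u) {K D P : ℝ}
    (hK : 0 ≤ K) (hD : 0 < D) (hP : 0 < P)
    (hb : ∀ (k : ℕ) ξ, ‖iteratedDeriv k u ξ‖ ≤ K * (D * (k : ℝ) ^ P) ^ k)
    {z : ℕ → ℝ} (hz : Function.Injective z) (hz0 : ∀ j, u (z j) = 0) {x δ : ℝ} (hδ : 0 < δ)
    (hd : ∀ j : ℕ, |x - z j| ≤ (j + 1) * δ) :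
    ‖u x‖ ≤ K * Real.exp 1 *
      Real.exp (-((Real.exp 1 ^ 2 * D * δ)⁻¹) ^ P⁻¹) := by
  set T := ((Real.exp 1 ^ 2 * D * δ)⁻¹) ^ P⁻¹ with hT
  have hT0 : 0 ≤ T := by positivity
  set k := ⌊T⌋₊
  have hkT : (k : ℝ) ≤ T := Nat.floor_le hT0
  have hkP : (k : ℝ) ^ P ≤ (Real.exp 1 ^ 2 * D * δ)⁻¹ := by
    rw [← Real.rpow_inv_rpow (x := (Real.exp 1 ^ 2 * D * δ)⁻¹) (by positivity) hP.ne']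
    gcongr
  have hcard : ((Finset.range k).image z).card = k := by
    rw [Finset.card_image_of_injective _ hz, Finset.card_range]
  have h := norm_le_of_zeros hu (s := (Finset.range k).image z) (x := x) (L := k * δ)
    (M := K * (D * (k : ℝ) ^ P) ^ k)
    (by simpa using fun j _ ↦ hz0 j)
    (by
      simp only [Finset.forall_mem_image, Finset.mem_range]
      intro j hj
      refine (hd j).trans ?_
      gcongr
      exact_mod_cast hj)
    (by rw [hcard]; exact hb k)
  rw [hcard] at h
  calc ‖u x‖ ≤ (k * δ) ^ k / k.factorial * (K * (D * (k : ℝ) ^ P) ^ k) := h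
    _ = (k : ℝ) ^ k / k.factorial * (K * (δ * (D * (k : ℝ) ^ P)) ^ k) := by
        simp only [mul_pow]; ring
    _ ≤ Real.exp 1 ^ k * (K * (δ * (D * (Real.exp 1 ^ 2 * D * δ)⁻¹)) ^ k) := by
        gcongr
        rw [div_le_iff₀ (by positivity)]
        exact pow_self_le_exp_mul_factorial k
    _ = K * Real.exp (-k) := by
        have : δ * (D * (Real.exp 1 ^ 2 * D * δ)⁻¹) = (Real.exp 1 ^ 2)⁻¹ := by field_simp
        have hexp : Real.exp 1 * (Real.exp 1 ^ 2)⁻¹ = Real.exp (-1) := by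
          rw [Real.exp_neg]
          field_simp
        rw [this, mul_left_comm, ← mul_pow, hexp, ← Real.exp_nat_mul, mul_neg_one]
    _ ≤ K * (Real.exp 1 * Real.exp (-T)) := by
        rw [← Real.exp_add]
        gcongr
        linarith [Nat.lt_floor_add_one T]
    _ = _ := by ring

theorem norm_le_of_symmetric_zeros {u : ℝ → ℂ} (hu : ContDiff ℝ (⊤ : ℕ∞) u) {K D P : ℝ}
    (hK : 0 ≤ K) (hD : 0 < D) (hP : 0 < P)
    (hb : ∀ (k : ℕ) ξ, ‖iteratedDeriv k u ξ‖ ≤ K * (D * (k : ℝ) ^ P) ^ k)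
    {a : ℕ → ℝ} (ha : StrictMono a) (hz : ∀ j, u (a j) = 0 ∧ u (-a j) = 0) {x δ : ℝ}
    (hδ : 0 < δ) {n : ℕ} (hgap : ∀ m, n ≤ m → a (m + 1) - a m ≤ δ)
    (hn : a n ≤ |x|) (hn' : |x| ≤ a (n + 1)) :
    ‖u x‖ ≤ K * Real.exp 1 *
      Real.exp (-((Real.exp 1 ^ 2 * D * δ)⁻¹) ^ P⁻¹) := by
  have hdist : ∀ j : ℕ, a (n + 1 + j) - a n ≤ (j + 1) * δ := by
    intro j
    induction j with
    | zero => simpa using hgap n le_rfl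
    | succ j ih =>
      have := hgap (n + 1 + j) (by omega)
      push_cast
      rw [← add_assoc]
      linarith
  have habs : ∀ j : ℕ, abs (|x| - a (n + 1 + j)) ≤ (j + 1) * δ := fun j ↦ by
    have := ha.monotone (show n + 1 ≤ n + 1 + j by omega)
    rw [abs_sub_comm, abs_of_nonneg (by linarith)]
    linarith [hdist j]
  have hinj : Function.Injective fun j ↦ a (n + 1 + j) :=
    ha.injective.comp (add_right_injective _)
  rcases abs_choice x with h | h
  · rw [h] at habs
    exact norm_le_of_zero_sequence hu hK hD hP hb hinj (fun j ↦ (hz _).1) hδ habs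
  · rw [h] at habs
    refine norm_le_of_zero_sequence hu hK hD hP hb (neg_injective.comp hinj)
      (fun j ↦ (hz _).2) hδ fun j ↦ ?_
    rw [← abs_neg]
    convert habs j using 2
    simp only [Function.comp]
    ring

theorem strictMono_natCast_rpow {α : ℝ} (hα : 0 < α) : StrictMono fun n : ℕ ↦ (n : ℝ) ^ α :=
  fun _ _ h ↦ Real.rpow_lt_rpow (Nat.cast_nonneg _) (by exact_mod_cast h) hα

theorem natCast_rpow_gap {α : ℝ} (hα0 : 0 < α) (hα1 : α < 1) {m n : ℕ} (h : n ≤ m) :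
    ((m + 1 : ℕ) : ℝ) ^ α - (m : ℝ) ^ α ≤ ((n : ℝ) + 1) ^ (α - 1) := by
  have hm : (0 : ℝ) < m + 1 := by positivity
  have h1 : (m : ℝ) / (m + 1) ≤ ((m : ℝ) / (m + 1)) ^ α := by
    refine Real.self_le_rpow_of_le_one (by positivity) ?_ hα1.le
    rw [div_le_one hm]
    linarith
  rw [Real.div_rpow (Nat.cast_nonneg m) hm.le, div_le_div_iff₀ hm (by positivity)] at h1
  calc ((m + 1 : ℕ) : ℝ) ^ α - (m : ℝ) ^ α ≤ ((m : ℝ) + 1) ^ (α - 1) := by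
        rw [Real.rpow_sub_one hm.ne', le_div_iff₀ hm]
        push_cast
        linarith
    _ ≤ ((n : ℝ) + 1) ^ (α - 1) := by
        refine Real.rpow_le_rpow_of_nonpos (by positivity) ?_ (by linarith)
        have : (n : ℝ) ≤ m := by exact_mod_cast h
        linarith

theorem GevreyBound.stretchedExpDecay_of_rpow_zeros {α : ℝ} (hα0 : 0 < α) (hα1 : α < 1)
    {u : ℝ → ℂ} (hu : ContDiff ℝ (⊤ : ℕ∞) u) (hb : GevreyBound u 1)
    (hz : ∀ n : ℕ, u ((n : ℝ) ^ α) = 0 ∧ u (-(n : ℝ) ^ α) = 0) :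
    StretchedExpDecay u ((1 - α) / α) := by
  obtain ⟨K, D, hK, hD, hb⟩ := hb
  refine ⟨K * Real.exp 1, (Real.exp 1 ^ 2 * D)⁻¹, by positivity, fun x ↦ ?_⟩
  set y := |x| ^ α⁻¹ with hy
  have hy0 : 0 ≤ y := by positivity
  have hyx : y ^ α = |x| := Real.rpow_inv_rpow (abs_nonneg x) hα0.ne'
  set n := ⌊y⌋₊
  have h1 : (n : ℝ) ^ α ≤ |x| := by
    rw [← hyx]
    have := Nat.floor_le hy0
    gcongr
  have hlt : y ≤ (n : ℝ) + 1 := (Nat.lt_floor_add_one y).le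
  have h2 : |x| ≤ ((n + 1 : ℕ) : ℝ) ^ α := by
    rw [← hyx]
    push_cast
    gcongr
  refine (norm_le_of_symmetric_zeros hu hK hD one_pos hb (strictMono_natCast_rpow hα0) hz
    (δ := ((n : ℝ) + 1) ^ (α - 1)) (by positivity)
    (fun m hm ↦ natCast_rpow_gap hα0 hα1 hm) h1 h2).trans ?_
  have h3 : |x| ^ ((1 - α) / α) ≤ (((n : ℝ) + 1) ^ (α - 1))⁻¹ := by
    rw [← Real.rpow_neg (by positivity), neg_sub, div_eq_inv_mul, Real.rpow_mul (abs_nonneg x)]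
    exact Real.rpow_le_rpow hy0 hlt (by linarith)
  rw [inv_one, Real.rpow_one, mul_inv]
  gcongr

theorem strictMono_log_natCast_add_one : StrictMono fun n : ℕ ↦ Real.log ((n : ℝ) + 1) :=
  fun _ _ h ↦ Real.log_lt_log (by positivity) (by gcongr)

theorem log_gap {m n : ℕ} (h : n ≤ m) :
    Real.log ((m + 1 : ℕ) + 1) - Real.log ((m : ℝ) + 1) ≤ ((n : ℝ) + 1)⁻¹ := by
  have hnm : (n : ℝ) ≤ m := by exact_mod_cast h
  rw [← Real.log_div (by positivity) (by positivity)]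
  refine (Real.log_le_sub_one_of_pos (by positivity)).trans ?_
  calc (((m + 1 : ℕ) : ℝ) + 1) / (m + 1) - 1 = ((m : ℝ) + 1)⁻¹ := by push_cast; field_simp; ring
    _ ≤ ((n : ℝ) + 1)⁻¹ := by gcongr

theorem exists_log_bracket {y : ℝ} (hy : 0 ≤ y) :
    ∃ n : ℕ, Real.log ((n : ℝ) + 1) ≤ y ∧ y ≤ Real.log ((n + 1 : ℕ) + 1) ∧
      ((n : ℝ) + 1)⁻¹ ≤ 2 * Real.exp (-y) := by
  have h0 : 0 ≤ Real.exp y - 1 := by linarith [Real.one_le_exp hy]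
  have h1 := Nat.floor_le h0
  have h2 := Nat.lt_floor_add_one (Real.exp y - 1)
  refine ⟨⌊Real.exp y - 1⌋₊, ?_, ?_, ?_⟩
  · rw [Real.log_le_iff_le_exp (by positivity)]
    linarith
  · rw [Real.le_log_iff_exp_le (by positivity)]
    push_cast
    linarith
  · rw [Real.exp_neg, ← div_eq_mul_inv, inv_le_comm₀ (by positivity) (by positivity), inv_div,
      div_le_iff₀ two_pos]
    have : (0 : ℝ) ≤ (⌊Real.exp y - 1⌋₊ : ℝ) := Nat.cast_nonneg _
    linarith

theorem stretchedExpDecay_one_of_log_zeros {u : ℝ → ℂ} (hu : ContDiff ℝ (⊤ : ℕ∞) u) {M : ℝ}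
    (hM : ∀ ξ, ‖iteratedDeriv 1 u ξ‖ ≤ M)
    (hz : ∀ n : ℕ, u (Real.log ((n : ℝ) + 1)) = 0 ∧ u (-Real.log ((n : ℝ) + 1)) = 0) :
    StretchedExpDecay u 1 := by
  refine ⟨2 * M, 1, one_pos, fun x ↦ ?_⟩
  have hM0 : 0 ≤ M := (norm_nonneg _).trans (hM 0)
  obtain ⟨n, h1, h2, h3⟩ := exists_log_bracket (abs_nonneg x)
  have hgap := log_gap (le_refl n)
  have hd : abs (|x| - Real.log ((n : ℝ) + 1)) ≤ 2 * Real.exp (-|x|) := by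
    rw [abs_of_nonneg (by linarith)]
    linarith
  obtain ⟨w, hw, hxw⟩ : ∃ w, u w = 0 ∧ |x - w| ≤ 2 * Real.exp (-|x|) := by
    rcases abs_choice x with h | h
    · exact ⟨_, (hz n).1, by rw [h] at hd ⊢; exact hd⟩
    · refine ⟨_, (hz n).2, ?_⟩
      have hneg : x - -Real.log ((n : ℝ) + 1) = -(|x| - Real.log ((n : ℝ) + 1)) := by
        rw [h]
        ring
      rwa [hneg, abs_neg]
  have h := norm_le_of_zeros hu (s := {w}) (x := x) (by simpa using hw) (by simpa using hxw)
    (by simpa using hM)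
  simp only [Finset.card_singleton, pow_one, Nat.factorial_one, Nat.cast_one, div_one] at h
  rw [Real.rpow_one, one_mul]
  linarith

theorem GevreyBound.stretchedExpDecay_of_log_zeros {P Q : ℝ} (hP : 0 < P) (hQ : 0 < Q)
    {u : ℝ → ℂ} (hu : ContDiff ℝ (⊤ : ℕ∞) u) (hb : GevreyBound u P)
    (hz : ∀ n : ℕ, u (Real.log ((n : ℝ) + 1)) = 0 ∧ u (-Real.log ((n : ℝ) + 1)) = 0) :
    StretchedExpDecay u Q := by
  obtain ⟨K, D, hK, hD, hb⟩ := hb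
  refine ⟨K * Real.exp 1, ((Real.exp 1 ^ 2 * D * 2)⁻¹) ^ P⁻¹ * ((Q / P⁻¹) ^ Q)⁻¹, by positivity,
    fun x ↦ ?_⟩
  obtain ⟨n, h1, h2, h3⟩ := exists_log_bracket (abs_nonneg x)
  refine (norm_le_of_symmetric_zeros hu hK hD hP hb strictMono_log_natCast_add_one hz
    (δ := 2 * Real.exp (-|x|)) (by positivity)
    (fun m hm ↦ (log_gap hm).trans h3) h1 h2).trans ?_
  have h4 : ((Real.exp 1 ^ 2 * D * (2 * Real.exp (-|x|)))⁻¹) ^ P⁻¹ =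
      ((Real.exp 1 ^ 2 * D * 2)⁻¹) ^ P⁻¹ * Real.exp (P⁻¹ * |x|) := by
    rw [← mul_assoc, mul_inv, Real.mul_rpow (by positivity) (by positivity), ← Real.exp_neg,
      neg_neg, ← Real.exp_mul, mul_comm |x|]
  have h5 := rpow_mul_exp_neg_le (abs_nonneg x) hQ (inv_pos.mpr hP)
  rw [← inv_mul_le_iff₀ (by positivity)] at h5
  rw [h4, mul_assoc (((Real.exp 1 ^ 2 * D * 2)⁻¹) ^ P⁻¹)]
  gcongr

/-- A Gevrey bound of small order is incompatible with zeros at all `n ^ α`. -/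
theorem GevreyBound.eq_zero_of_rpow_zeros {α ε : ℝ} (hα0 : 0 < α) (hαε : α + ε < 1)
    {u : ℝ → ℂ} (hu : ContDiff ℝ (⊤ : ℕ∞) u) (hb : GevreyBound u ε)
    (hz : ∀ n : ℕ, u ((n : ℝ) ^ α) = 0) (x : ℝ) : u x = 0 := by
  obtain ⟨K, D, hK, hD, hb⟩ := hb
  have hlarge : ∀ᶠ k : ℕ in Filter.atTop, |x| ≤ (k : ℝ) ^ α :=
    ((tendsto_rpow_atTop hα0).comp tendsto_natCast_atTop_atTop).eventually_ge_atTop _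
  have hsmall : ∀ᶠ k : ℕ in Filter.atTop,
      2 * Real.exp 1 * D * (k : ℝ) ^ (-(1 - α - ε)) < 1 / 2 := by
    have h := (((tendsto_rpow_neg_atTop (y := 1 - α - ε) (by linarith)).comp
      tendsto_natCast_atTop_atTop).const_mul (2 * Real.exp 1 * D))
    rw [mul_zero] at h
    exact h.eventually_lt_const (by norm_num)
  have hbound : ∀ᶠ k : ℕ in Filter.atTop, ‖u x‖ ≤ K * (1 / 2 : ℝ) ^ k := by
    filter_upwards [hlarge, hsmall, Filter.eventually_gt_atTop 0] with k hk1 hk2 hk0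
    have hk0' : (0 : ℝ) < k := by exact_mod_cast hk0
    have hcard : ((Finset.range k).image fun j : ℕ ↦ (j : ℝ) ^ α).card = k := by
      rw [Finset.card_image_of_injective _ (strictMono_natCast_rpow hα0).injective,
        Finset.card_range]
    have h := norm_le_of_zeros hu (s := (Finset.range k).image fun j : ℕ ↦ (j : ℝ) ^ α)
      (x := x) (L := 2 * (k : ℝ) ^ α) (M := K * (D * (k : ℝ) ^ ε) ^ k)
      (by simpa using fun j _ ↦ hz j)
      (by
        simp only [Finset.forall_mem_image, Finset.mem_range]
        intro j hj
        have hj0 : (0 : ℝ) ≤ (j : ℝ) ^ α := by positivity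
        have hjk : (j : ℝ) ^ α ≤ (k : ℝ) ^ α := (strictMono_natCast_rpow hα0).monotone hj.le
        refine (abs_sub _ _).trans ?_
        rw [abs_of_nonneg hj0]
        linarith)
      (by rw [hcard]; exact hb k)
    rw [hcard] at h
    have hfac : (1 : ℝ) / k.factorial ≤ (Real.exp 1 / k) ^ k := by
      rw [div_pow, div_le_div_iff₀ (by positivity) (by positivity), one_mul]
      exact pow_self_le_exp_mul_factorial k
    calc ‖u x‖ ≤ (2 * (k : ℝ) ^ α) ^ k / k.factorial * (K * (D * (k : ℝ) ^ ε) ^ k) := h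
      _ = (1 : ℝ) / k.factorial * (K * (2 * (k : ℝ) ^ α * (D * (k : ℝ) ^ ε)) ^ k) := by
          simp only [mul_pow]; ring
      _ ≤ (Real.exp 1 / k) ^ k * (K * (2 * (k : ℝ) ^ α * (D * (k : ℝ) ^ ε)) ^ k) := by
          exact mul_le_mul_of_nonneg_right hfac (by positivity)
      _ = K * (2 * Real.exp 1 * D * (k : ℝ) ^ (-(1 - α - ε))) ^ k := by
          have : (k : ℝ) ^ (-(1 - α - ε)) = (k : ℝ) ^ α * (k : ℝ) ^ ε / k := by
            rw [← Real.rpow_add hk0', ← Real.rpow_sub_one hk0'.ne']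
            congr 1
            ring
          rw [this, mul_left_comm, ← mul_pow]
          congr 2
          ring
      _ ≤ K * (1 / 2 : ℝ) ^ k := by gcongr
  have hlim : Filter.Tendsto (fun k : ℕ ↦ K * (1 / 2 : ℝ) ^ k) Filter.atTop (nhds 0) := by
    simpa using (tendsto_pow_atTop_nhds_zero_of_lt_one (r := (1 / 2 : ℝ)) (by norm_num)
      (by norm_num)).const_mul K
  exact norm_le_zero_iff.mp (ge_of_tendsto hlim hbound)

theorem fourierTransform_eq_fourier_neg (f : ℝ → ℂ) (ξ : ℝ) :
    fourierTransform f ξ = 𝓕 f (-ξ) := by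
  rw [fourierTransform, Real.fourier_real_eq_integral_exp_smul]
  congr 1
  ext x
  rw [smul_eq_mul, mul_comm]
  congr 2
  push_cast
  ring

theorem fourier_fourier_apply (f : SchwartzMap ℝ ℂ) (x : ℝ) :
    𝓕 (𝓕 (f : ℝ → ℂ)) x = f (-x) := by
  have h : 𝓕⁻ (𝓕 f) = f := FourierTransform.fourierInv_fourier_eq f
  have h2 := congrArg (fun g : SchwartzMap ℝ ℂ ↦ g (-x)) h
  simp only [SchwartzMap.fourierInv_coe, SchwartzMap.fourier_coe] at h2
  rw [← h2, Real.fourierInv_eq_fourier_neg, neg_neg]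

theorem uniqueness_log_power (α : ℝ) (hα0 : 0 < α) (hα1 : α < 1)
    (f : SchwartzMap ℝ ℂ)
    (hf : ∀ n : ℕ, f (Real.log (n + 1)) = 0 ∧ f (-Real.log (n + 1)) = 0)
    (hfhat : ∀ n : ℕ, fourierTransform f ((n : ℝ) ^ α) = 0 ∧
      fourierTransform f (-(n : ℝ) ^ α) = 0) :
    ∀ x : ℝ, f x = 0 := by
  have hsmooth : ContDiff ℝ (⊤ : ℕ∞) (𝓕 (f : ℝ → ℂ)) := (𝓕 f).smooth _
  have hsmooth' : ContDiff ℝ (⊤ : ℕ∞) (𝓕 (𝓕 (f : ℝ → ℂ))) := (𝓕 (𝓕 f)).smooth _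
  have hg : ∀ n : ℕ, 𝓕 (f : ℝ → ℂ) ((n : ℝ) ^ α) = 0 ∧ 𝓕 (f : ℝ → ℂ) (-(n : ℝ) ^ α) = 0 := by
    intro n
    have h := hfhat n
    rw [fourierTransform_eq_fourier_neg, fourierTransform_eq_fourier_neg, neg_neg] at h
    exact h.symm
  have hh : ∀ n : ℕ, 𝓕 (𝓕 (f : ℝ → ℂ)) (Real.log ((n : ℝ) + 1)) = 0 ∧
      𝓕 (𝓕 (f : ℝ → ℂ)) (-Real.log ((n : ℝ) + 1)) = 0 := by
    intro n
    rw [fourier_fourier_apply, fourier_fourier_apply, neg_neg]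
    exact (hf n).symm
  have hβ : 0 < (1 - α) / α := div_pos (by linarith) hα0
  have hf_decay : StretchedExpDecay f 1 :=
    stretchedExpDecay_one_of_log_zeros (f.smooth _)
      (fun ξ ↦ by simpa using f.le_seminorm' ℝ 0 1 ξ) hf
  have hg_decay : StretchedExpDecay (𝓕 f : SchwartzMap ℝ ℂ) ((1 - α) / α) :=
    (inv_one (G := ℝ) ▸ hf_decay.gevreyBound_fourier one_pos).stretchedExpDecay_of_rpow_zeros
      hα0 hα1 hsmooth hg
  have hQ : 0 < 2 / (1 - α) := div_pos two_pos (by linarith)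
  have hh_decay : StretchedExpDecay (𝓕 (𝓕 (f : ℝ → ℂ))) (2 / (1 - α)) :=
    (hg_decay.gevreyBound_fourier hβ).stretchedExpDecay_of_log_zeros (inv_pos.mpr hβ) hQ
      hsmooth' hh
  have hf_decay' : StretchedExpDecay f (2 / (1 - α)) := by
    obtain ⟨C, c, hc, h⟩ := hh_decay
    refine ⟨C, c, hc, fun x ↦ ?_⟩
    simpa [fourier_fourier_apply] using h (-x)
  have hg_zero : ∀ ξ, 𝓕 (f : ℝ → ℂ) ξ = 0 :=
    (hf_decay'.gevreyBound_fourier hQ).eq_zero_of_rpow_zeros hα0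
      (by rw [inv_div]; linarith) hsmooth fun n ↦ (hg n).1
  intro x
  rw [← neg_neg x, ← fourier_fourier_apply, show 𝓕 (f : ℝ → ℂ) = 0 from funext hg_zero]
  simp [Real.fourier_real_eq_integral_exp_smul]
end

section
/- Let f be a Schwartz function on ℝ, let k ≥ 0 be a natural number, and suppose the k-th derivative of f vanishes at a point a ∈ ℝ. Then for every x ∈ ℝ, |f^{(k)}(x)| ≤ (2π)^{k+1} · I_{k+1}(f̂) · |x − a|, where I_{k+1}(f̂) = ∫_ℝ |f̂(y)| |y|^{k+1} dy. -/
open MeasureTheory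

/-- The weighted integral `I_k(g) = ∫_ℝ |g(y)| |y|^k dy`. -/
noncomputable def weightedIntegral (g : ℝ → ℂ) (k : ℕ) : ℝ :=
  ∫ y : ℝ, ‖g y‖ * |y| ^ k

open FourierTransform in
theorem fourierTransform_eq_fourierInv (f : SchwartzMap ℝ ℂ) :
    fourierTransform f = (𝓕⁻ f : SchwartzMap ℝ ℂ) := by
  ext ξ
  rw [SchwartzMap.fourierInv_coe, Real.fourierInv_eq']
  refine integral_congr_ae (.of_forall fun x => ?_)
  simp only [smul_eq_mul, RCLike.inner_apply, conj_trivial]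
  rw [mul_comm]
  congr 2
  push_cast
  ring

open FourierTransform in
theorem norm_iteratedDeriv_le_weightedIntegral (f : SchwartzMap ℝ ℂ) (n : ℕ) (x : ℝ) :
    ‖iteratedDeriv n f x‖ ≤
      (2 * Real.pi) ^ n * weightedIntegral (fourierTransform f) n := by
  rw [fourierTransform_eq_fourierInv]
  set g : SchwartzMap ℝ ℂ := 𝓕⁻ f with hg
  have hf : (f : ℝ → ℂ) = 𝓕 (g : ℝ → ℂ) := by
    rw [← SchwartzMap.fourier_coe, hg, FourierTransform.fourier_fourierInv_eq]
  have hint (m : ℕ) (_ : (m : ℕ∞) ≤ (n : ℕ∞)) : Integrable fun y : ℝ => y ^ m • g y := by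
    refine (g.integrable_pow_mul volume m).mono' (by fun_prop) (.of_forall fun y => ?_)
    simp
  rw [hf, Real.iteratedDeriv_fourier hint le_rfl, weightedIntegral, ← integral_const_mul,
    Real.fourier_eq]
  refine (norm_integral_le_integral_norm _).trans_eq
    (integral_congr_ae (.of_forall fun y => ?_))
  simp [Circle.norm_smul, abs_of_pos Real.pi_pos, mul_pow]
  ring

theorem derivative_bound_near_zero (f : SchwartzMap ℝ ℂ) (k : ℕ) (a : ℝ)
    (ha : iteratedDeriv k f a = 0) :
    ∀ x : ℝ, ‖iteratedDeriv k f x‖ ≤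
      (2 * Real.pi) ^ (k + 1) * weightedIntegral (fourierTransform f) (k + 1) * |x - a| := by
  intro x
  have hd : Differentiable ℝ (iteratedDeriv k f) :=
    (f.smooth (k + 1)).differentiable_iteratedDeriv k (by exact_mod_cast k.lt_succ_self)
  have := convex_univ.norm_image_sub_le_of_norm_deriv_le (fun y _ => hd y)
    (fun y _ => by
      simpa only [iteratedDeriv_succ] using norm_iteratedDeriv_le_weightedIntegral f (k + 1) y)
    (Set.mem_univ a) (Set.mem_univ x)
  simpa [ha] using this
end

section
/- Let 0 < α < 1 and let f be a Schwartz function on ℝ with f(log(n+1)) = f(-log(n+1)) = 0 and f̂(n^α) = f̂(-n^α) = 0 for every natural number n ≥ 0. Then there exists a constant C > 0 depending only on f such that I_j(f) ≤ C · j! for every natural number j ≥ 1, where I_j(f) = ∫_ℝ |f(y)| |y|^j dy. -/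
open MeasureTheory

theorem integral_exp_neg_abs_mul_abs_pow (j : ℕ) :
    ∫ y : ℝ, Real.exp (-|y|) * |y| ^ j = 2 * (Nat.factorial j : ℝ) := by
  rw [integral_comp_abs (f := fun y => Real.exp (-y) * y ^ j), ← Real.Gamma_nat_eq_factorial,
    Real.Gamma_eq_integral (by positivity)]
  simp

theorem integrable_exp_neg_abs_mul_abs_pow (j : ℕ) :
    Integrable (fun y : ℝ => Real.exp (-|y|) * |y| ^ j) := by
  refine Integrable.of_integral_ne_zero ?_
  rw [integral_exp_neg_abs_mul_abs_pow]
  positivity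

/-- Every `x ≥ 0` lies within `2 e^{-x}` of the logarithm of a positive integer. -/
theorem exists_abs_sub_log_le {x : ℝ} (hx : 0 ≤ x) :
    ∃ n : ℕ, |x - Real.log (n + 1)| ≤ 2 * Real.exp (-x) := by
  have h1 : 1 ≤ Real.exp x := Real.one_le_exp hx
  obtain ⟨n, hn, hn'⟩ : ∃ n : ℕ, (n : ℝ) + 1 ≤ Real.exp x ∧ Real.exp x < n + 2 :=
    ⟨⌊Real.exp x - 1⌋₊, by linarith [Nat.floor_le (sub_nonneg.2 h1)],
      by linarith [Nat.lt_floor_add_one (Real.exp x - 1)]⟩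
  have hpos : (0 : ℝ) < n + 1 := by positivity
  have hle : Real.log (n + 1) ≤ x := (Real.log_le_iff_le_exp hpos).2 hn
  refine ⟨n, ?_⟩
  rw [abs_of_nonneg (sub_nonneg.2 hle)]
  have hlog : x - Real.log (n + 1) ≤ Real.exp x / (n + 1) - 1 := by
    have h := Real.log_le_sub_one_of_pos (div_pos (Real.exp_pos x) hpos)
    rwa [Real.log_div (Real.exp_pos x).ne' hpos.ne', Real.log_exp] at h
  refine hlog.trans ?_
  rw [Real.exp_neg, ← div_eq_mul_inv, div_sub_one hpos.ne', div_le_div_iff₀ hpos (Real.exp_pos x)]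
  nlinarith [Nat.cast_nonneg (α := ℝ) n]

/-- A Lipschitz function vanishing at `± log (n + 1)` for all `n` decays exponentially. -/
theorem norm_le_exp_neg_abs_of_lipschitz {f : ℝ → ℂ} {K : NNReal} (hK : LipschitzWith K f)
    (hf : ∀ n : ℕ, f (Real.log (n + 1)) = 0 ∧ f (-Real.log (n + 1)) = 0) (x : ℝ) :
    ‖f x‖ ≤ 2 * K * Real.exp (-|x|) := by
  obtain ⟨n, hn⟩ := exists_abs_sub_log_le (abs_nonneg x)
  obtain ⟨z, hz, hxz⟩ : ∃ z, f z = 0 ∧ |x - z| ≤ 2 * Real.exp (-|x|) := by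
    rcases abs_cases x with ⟨h, -⟩ | ⟨h, -⟩
    · exact ⟨_, (hf n).1, by rwa [h] at hn ⊢⟩
    · refine ⟨_, (hf n).2, ?_⟩
      rw [h] at hn ⊢
      rwa [show x - -Real.log (n + 1) = -(-x - Real.log (n + 1)) by ring, abs_neg]
  have h := hK.dist_le_mul x z
  rw [hz, dist_zero_right, Real.dist_eq] at h
  nlinarith [K.coe_nonneg]

theorem SchwartzMap.exists_lipschitzWith (f : SchwartzMap ℝ ℂ) :
    ∃ K : NNReal, LipschitzWith K f := by
  obtain ⟨C, hC⟩ := f.decay' 0 1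
  refine ⟨C.toNNReal, lipschitzWith_of_nnnorm_fderiv_le f.differentiable fun x => ?_⟩
  have h := hC x
  rw [pow_zero, one_mul] at h
  rw [← NNReal.coe_le_coe, coe_nnnorm, ← norm_iteratedFDeriv_one]
  exact h.trans (Real.le_coe_toNNReal C)

theorem weighted_integral_factorial_bound (α : ℝ) (hα0 : 0 < α) (hα1 : α < 1)
    (f : SchwartzMap ℝ ℂ)
    (hf : ∀ n : ℕ, f (Real.log (n + 1)) = 0 ∧ f (-Real.log (n + 1)) = 0)
    (hfhat : ∀ n : ℕ, fourierTransform f ((n : ℝ) ^ α) = 0 ∧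
      fourierTransform f (-(n : ℝ) ^ α) = 0) :
    ∃ C > 0, ∀ j : ℕ, 1 ≤ j →
      weightedIntegral f j ≤ C * (Nat.factorial j : ℝ) := by
  obtain ⟨K, hK⟩ := f.exists_lipschitzWith
  refine ⟨4 * K + 1, by positivity, fun j _ => ?_⟩
  calc weightedIntegral f j
      ≤ ∫ y : ℝ, 2 * K * (Real.exp (-|y|) * |y| ^ j) := by
        refine integral_mono_of_nonneg (.of_forall fun y => by positivity)
          ((integrable_exp_neg_abs_mul_abs_pow j).const_mul _) (.of_forall fun y => ?_)
        simp only [← mul_assoc]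
        gcongr
        exact norm_le_exp_neg_abs_of_lipschitz hK hf y
    _ = 4 * K * (Nat.factorial j : ℝ) := by
        rw [integral_const_mul, integral_exp_neg_abs_mul_abs_pow]
        ring
    _ ≤ (4 * K + 1) * (Nat.factorial j : ℝ) := by
        gcongr
        linarith
end
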